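/- Let (α_n) and (β_n) be sequences with α_n, β_n > −1 such that α_n/n → ∞, β_n/n → ∞ and α_n/β_n → c for some c > 0 as n → ∞, and let s_n denote the largest zero of P_n^{(α_n,β_n)}. Then limsup_{n→∞} √(α_n/n)·(s_n + (α_n−β_n)/(α_n+β_n)) ≤ 4c/(1+c)^{3/2}. -/

import Mathlib

open Filter Topology

/-- Generalized binomial coefficient C(t, m) = t(t-1)⋯(t-m+1)/m! for real t. -/
noncomputable def genBinom (t : ℝ) (m : ℕ) : ℝ :=
  (∏ i ∈ Finset.range m, (t - (i : ℝ))) / (Nat.factorial m)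

/-- Jacobi polynomial P_n^{(α,β)}. -/
noncomputable def jacobiP (n : ℕ) (α β : ℝ) (x : ℝ) : ℝ :=
  ∑ k ∈ Finset.range (n + 1),
    genBinom ((n : ℝ) + α) (n - k) * genBinom ((n : ℝ) + β) k *
      ((x - 1) / 2) ^ k * ((x + 1) / 2) ^ (n - k)

/-- Number of zeros of P_n^{(α,β)} that are ≤ ξ. -/
noncomputable def jacobiN (n : ℕ) (α β ξ : ℝ) : ℕ :=
  {x : ℝ | jacobiP n α β x = 0 ∧ x ≤ ξ}.ncard

/-- A solution of `(1 - x²) y'' + q y' + l y = 0` that is positive at `1` stays positive to the left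
of `1` as long as `(1 - x²) K² + q K + l < 0`. -/
theorem pos_of_barrier {y y₁ y₂ q : ℝ → ℝ} {K l s : ℝ} (hs : s < 1) (hs' : -1 < s)
    (hy : ∀ x, HasDerivAt y (y₁ x) x) (hy₁ : ∀ x, HasDerivAt y₁ (y₂ x) x)
    (hode : ∀ x, (1 - x ^ 2) * y₂ x + q x * y₁ x + l * y x = 0)
    (hq : q 1 < 0) (hpos : 0 < y 1)
    (hF : ∀ x ∈ Set.Icc s 1, (1 - x ^ 2) * K ^ 2 + q x * K + l < 0) : y s ≠ 0 := by
  intro hys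
  have hm : ∀ x, HasDerivAt (fun x => Real.exp (-K * x) * y x)
      (Real.exp (-K * x) * (y₁ x - K * y x)) x := fun x => by
    have h := (((hasDerivAt_id x).const_mul (-K)).exp).mul (hy x)
    refine h.congr_deriv ?_
    simp; ring
  have hm₁ : ∀ x, HasDerivAt (fun x => Real.exp (-K * x) * (y₁ x - K * y x))
      (Real.exp (-K * x) * (y₂ x - 2 * K * y₁ x + K ^ 2 * y x)) x := fun x => by
    have h := (((hasDerivAt_id x).const_mul (-K)).exp).mul ((hy₁ x).sub ((hy x).const_mul K))
    refine h.congr_deriv ?_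
    simp; ring
  set m := fun x => Real.exp (-K * x) * y x with hmdef
  have hcont : Continuous m := continuous_iff_continuousAt.2 fun x => (hm x).continuousAt
  obtain ⟨z, hz, hmax⟩ := isCompact_Icc.exists_isMaxOn (Set.nonempty_Icc.2 hs.le)
    hcont.continuousOn
  have hm1 : 0 < m 1 := mul_pos (Real.exp_pos _) hpos
  have hmz : 0 < m z := hm1.trans_le (hmax (Set.right_mem_Icc.2 hs.le))
  have hyz : 0 < y z := pos_of_mul_pos_right hmz (Real.exp_pos _).le
  have hzs : s < z := by
    refine lt_of_le_of_ne hz.1 ?_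
    rintro rfl
    exact hyz.ne' hys
  rcases hz.2.lt_or_eq with hz1 | rfl
  · have hlmax : IsLocalMax m z := hmax.isLocalMax (Icc_mem_nhds hzs hz1)
    have hd : deriv m = fun x => Real.exp (-K * x) * (y₁ x - K * y x) :=
      funext fun x => (hm x).deriv
    have hzero : y₁ z = K * y z := by
      have := hlmax.hasDerivAt_eq_zero (hm z)
      have := (mul_eq_zero.1 this).resolve_left (Real.exp_pos _).ne'
      linarith
    have hdd : deriv (deriv m) z = Real.exp (-K * z) * (y₂ z - 2 * K * y₁ z + K ^ 2 * y z) := by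
      rw [hd]; exact (hm₁ z).deriv
    have hddpos : 0 < deriv (deriv m) z := by
      rw [hdd]
      refine mul_pos (Real.exp_pos _) ?_
      have h1 := hode z
      have h2 := mul_neg_of_neg_of_pos (hF z hz) hyz
      have h3 : 0 < 1 - z ^ 2 := by nlinarith
      rw [hzero] at h1 ⊢
      refine pos_of_mul_pos_right (a := 1 - z ^ 2) ?_ h3.le
      nlinarith
    have hlmin : IsLocalMin m z := isLocalMin_of_deriv_deriv_pos hddpos
      (by rw [hd]; simp [hzero]) hcont.continuousAt
    have hev : m =ᶠ[𝓝 z] fun _ => m z := by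
      filter_upwards [hlmax, hlmin] with x h1 h2 using le_antisymm h1 h2
    have : deriv (deriv m) z = 0 := by
      rw [hev.deriv.deriv_eq]; simp
    exact hddpos.ne' this
  · have hslope := (hasDerivAt_iff_tendsto_slope_left_right.1 (hm 1)).1
    have hge : 0 ≤ Real.exp (-K * 1) * (y₁ 1 - K * y 1) := by
      refine ge_of_tendsto hslope ?_
      filter_upwards [Ioo_mem_nhdsLT hs] with x hx
      have h1 : m x ≤ m 1 := hmax ⟨hx.1.le, hx.2.le⟩
      rw [slope_def_field]
      exact div_nonneg_of_nonpos (sub_nonpos.2 h1) (sub_nonpos.2 hx.2.le)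
    have hge' := nonneg_of_mul_nonneg_right hge (Real.exp_pos _)
    have h1 := hode 1
    have h2 := mul_neg_of_neg_of_pos (hF 1 hz) hyz
    nlinarith [mul_nonneg_of_nonpos_of_nonpos hq.le (neg_nonpos.2 hge')]

theorem genBinom_succ (t : ℝ) (m : ℕ) :
    genBinom t (m + 1) * (m + 1) = genBinom t m * (t - m) := by
  unfold genBinom
  rw [Finset.prod_range_succ, Nat.factorial_succ]
  have := Nat.factorial_ne_zero m
  push_cast
  field_simp

theorem genBinom_pos {t : ℝ} {m : ℕ} (h : (m : ℝ) - 1 < t) : 0 < genBinom t m := by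
  unfold genBinom
  refine div_pos (Finset.prod_pos fun i hi => ?_) (by positivity)
  have : (i : ℝ) + 1 ≤ m := by exact_mod_cast Finset.mem_range.1 hi
  linarith

theorem jacobiP_pos_of_one_le {n : ℕ} {α β x : ℝ} (hα : -1 < α) (hβ : -1 < β) (hx : 1 ≤ x) :
    0 < jacobiP n α β x := by
  have h1 : 0 ≤ (x - 1) / 2 := by linarith
  have h2 : 0 < (x + 1) / 2 := by linarith
  have hA : ∀ k ≤ n, 0 < genBinom ((n : ℝ) + α) k := fun k hk => genBinom_pos (by
    have : (k : ℝ) ≤ n := by exact_mod_cast hk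
    linarith)
  have hB : ∀ k ≤ n, 0 < genBinom ((n : ℝ) + β) k := fun k hk => genBinom_pos (by
    have : (k : ℝ) ≤ n := by exact_mod_cast hk
    linarith)
  unfold jacobiP
  refine Finset.sum_pos' (fun k hk => ?_) ⟨0, by simp, ?_⟩
  · have hk' : k ≤ n := Nat.lt_succ_iff.1 (Finset.mem_range.1 hk)
    have := hA (n - k) (Nat.sub_le _ _)
    have := hB k hk'
    positivity
  · have := hA n le_rfl
    have := hB 0 (Nat.zero_le _)
    simp only [Nat.sub_zero, pow_zero, mul_one]
    positivity

/-- The derivative of `((x - 1) / 2) ^ i * ((x + 1) / 2) ^ j`. -/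
noncomputable def bernsteinDeriv (i j : ℕ) (x : ℝ) : ℝ :=
  (i * (((x - 1) / 2) ^ (i - 1) * ((x + 1) / 2) ^ j)
    + j * (((x - 1) / 2) ^ i * ((x + 1) / 2) ^ (j - 1))) / 2

/-- The second derivative of `((x - 1) / 2) ^ i * ((x + 1) / 2) ^ j`. -/
noncomputable def bernsteinDeriv₂ (i j : ℕ) (x : ℝ) : ℝ :=
  (i * bernsteinDeriv (i - 1) j x + j * bernsteinDeriv i (j - 1) x) / 2

theorem hasDerivAt_bernstein (i j : ℕ) (x : ℝ) :
    HasDerivAt (fun x : ℝ => ((x - 1) / 2) ^ i * ((x + 1) / 2) ^ j) (bernsteinDeriv i j x) x := by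
  have h1 := (((hasDerivAt_id x).sub_const 1).div_const 2).pow i
  have h2 := (((hasDerivAt_id x).add_const 1).div_const 2).pow j
  refine (h1.mul h2).congr_deriv ?_
  simp only [bernsteinDeriv, id, Pi.pow_apply]
  ring

theorem hasDerivAt_bernsteinDeriv (i j : ℕ) (x : ℝ) :
    HasDerivAt (bernsteinDeriv i j) (bernsteinDeriv₂ i j x) x :=
  (((hasDerivAt_bernstein (i - 1) j x).const_mul (i : ℝ)).add
    ((hasDerivAt_bernstein i (j - 1) x).const_mul (j : ℝ))).div_const 2

theorem bernstein_ode (i j : ℕ) (α β x : ℝ) :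
    (1 - x ^ 2) * bernsteinDeriv₂ i j x
      + (β - α - (α + β + 2) * x) * bernsteinDeriv i j x
      + (i + j) * (i + j + α + β + 1) * (((x - 1) / 2) ^ i * ((x + 1) / 2) ^ j)
    = (j * (j + β) + i * (i + α)) * (((x - 1) / 2) ^ i * ((x + 1) / 2) ^ j)
      - i * (i + α) * (((x - 1) / 2) ^ (i - 1) * ((x + 1) / 2) ^ (j + 1))
      - j * (j + β) * (((x - 1) / 2) ^ (i + 1) * ((x + 1) / 2) ^ (j - 1)) := by
  obtain ⟨a, rfl⟩ : ∃ a, x = 2 * a + 1 := ⟨(x - 1) / 2, by ring⟩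
  have ha : (2 * a + 1 - 1) / 2 = a := by ring
  have hb : (2 * a + 1 + 1) / 2 = a + 1 := by ring
  simp only [bernsteinDeriv₂, bernsteinDeriv, ha, hb]
  rcases i with _ | _ | i <;> rcases j with _ | _ | j <;>
    simp only [Nat.add_sub_cancel, Nat.zero_sub, zero_add, Nat.sub_self] <;> push_cast <;> ring

theorem jacobiP_exists_ode (n : ℕ) (α β : ℝ) : ∃ y₁ y₂ : ℝ → ℝ,
    (∀ x, HasDerivAt (jacobiP n α β) (y₁ x) x) ∧ (∀ x, HasDerivAt y₁ (y₂ x) x) ∧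
    ∀ x, (1 - x ^ 2) * y₂ x + (β - α - (α + β + 2) * x) * y₁ x
      + n * (n + α + β + 1) * jacobiP n α β x = 0 := by
  set C : ℕ → ℝ := fun k => genBinom ((n : ℝ) + α) (n - k) * genBinom ((n : ℝ) + β) k with hC
  have hP : jacobiP n α β = fun x => ∑ k ∈ Finset.range (n + 1),
      C k * (((x - 1) / 2) ^ k * ((x + 1) / 2) ^ (n - k)) := by
    funext x
    simp only [jacobiP, hC, mul_assoc]
  refine ⟨fun x => ∑ k ∈ Finset.range (n + 1), C k * bernsteinDeriv k (n - k) x,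
    fun x => ∑ k ∈ Finset.range (n + 1), C k * bernsteinDeriv₂ k (n - k) x,
    fun x => ?_, fun x => ?_, fun x => ?_⟩
  · rw [hP]
    exact HasDerivAt.fun_sum fun k _ => (hasDerivAt_bernstein k (n - k) x).const_mul _
  · exact HasDerivAt.fun_sum fun k _ => (hasDerivAt_bernsteinDeriv k (n - k) x).const_mul _
  rw [hP]
  set T : ℕ → ℝ := fun k => ((x - 1) / 2) ^ k * ((x + 1) / 2) ^ (n - k) with hT
  have hrec : ∀ k < n, C (k + 1) * ((k + 1) * (k + 1 + α)) =
      C k * (((n - k : ℕ) : ℝ) * ((n - k : ℕ) + β)) := by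
    intro k hk
    obtain ⟨m, rfl⟩ : ∃ m, n = k + 1 + m := ⟨n - (k + 1), by omega⟩
    have e1 : k + 1 + m - (k + 1) = m := by omega
    have e2 : k + 1 + m - k = m + 1 := by omega
    simp only [hC, e1, e2]
    have h1 := genBinom_succ (((k + 1 + m : ℕ) : ℝ) + α) m
    have h2 := genBinom_succ (((k + 1 + m : ℕ) : ℝ) + β) k
    push_cast at h1 h2 ⊢
    linear_combination (genBinom (k + 1 + m + α) m * (k + 1 + α)) * h2
      - (genBinom (k + 1 + m + β) k * (k + 1 + m + β - k)) * h1
  have hdown : ∑ k ∈ Finset.range (n + 1), C k * (k * (k + α)) *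
        (((x - 1) / 2) ^ (k - 1) * ((x + 1) / 2) ^ (n - k + 1)) =
      ∑ k ∈ Finset.range (n + 1), C k * (((n - k : ℕ) : ℝ) * ((n - k : ℕ) + β)) * T k := by
    rw [Finset.sum_range_succ', Finset.sum_range_succ _ n]
    simp only [Nat.cast_zero, zero_mul, mul_zero, Nat.sub_self, add_zero]
    refine Finset.sum_congr rfl fun k hk => ?_
    have hk' := Finset.mem_range.1 hk
    have e : n - (k + 1) + 1 = n - k := by omega
    rw [← hrec k hk', e, Nat.add_sub_cancel, hT]
    push_cast
    ring
  have hup : ∑ k ∈ Finset.range (n + 1), C k * (((n - k : ℕ) : ℝ) * ((n - k : ℕ) + β)) *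
        (((x - 1) / 2) ^ (k + 1) * ((x + 1) / 2) ^ (n - k - 1)) =
      ∑ k ∈ Finset.range (n + 1), C k * (k * (k + α)) * T k := by
    rw [Finset.sum_range_succ, Finset.sum_range_succ' _ n]
    simp only [Nat.cast_zero, zero_mul, mul_zero, Nat.sub_self, add_zero]
    refine Finset.sum_congr rfl fun k hk => ?_
    have hk' := Finset.mem_range.1 hk
    rw [← hrec k hk', hT, Nat.sub_sub]
    push_cast
    ring
  have hterm : ∀ k ∈ Finset.range (n + 1),
      (1 - x ^ 2) * (C k * bernsteinDeriv₂ k (n - k) x)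
        + (β - α - (α + β + 2) * x) * (C k * bernsteinDeriv k (n - k) x)
        + n * (n + α + β + 1) * (C k * T k)
      = C k * (((n - k : ℕ) : ℝ) * ((n - k : ℕ) + β)) * T k + C k * (k * (k + α)) * T k
        - C k * (k * (k + α)) * (((x - 1) / 2) ^ (k - 1) * ((x + 1) / 2) ^ (n - k + 1))
        - C k * (((n - k : ℕ) : ℝ) * ((n - k : ℕ) + β)) *
          (((x - 1) / 2) ^ (k + 1) * ((x + 1) / 2) ^ (n - k - 1)) := by
    intro k hk
    have hk' : k ≤ n := Nat.lt_succ_iff.1 (Finset.mem_range.1 hk)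
    have hn : (n : ℝ) = k + (n - k : ℕ) := by rw [← Nat.cast_add, Nat.add_sub_cancel' hk']
    have h := bernstein_ode k (n - k) α β x
    rw [← hn] at h
    simp only [hT]
    linear_combination C k * h
  rw [Finset.mul_sum, Finset.mul_sum, Finset.mul_sum, ← Finset.sum_add_distrib,
    ← Finset.sum_add_distrib, Finset.sum_congr rfl hterm, Finset.sum_sub_distrib,
    Finset.sum_sub_distrib, Finset.sum_add_distrib, hdown, hup]
  ring

/-- Any zero of the Jacobi polynomial lies to the left of a point `x₀ ≥ -1` at which
`(1 - x²) K² + (β - α - (α + β + 2) x) K + n (n + α + β + 1)` is negative for some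
`0 ≤ K ≤ (α + β + 2) / 2`. -/
theorem jacobiP_zero_lt {n : ℕ} {α β K x₀ s : ℝ} (hα : -1 < α) (hβ : -1 < β)
    (hK : 0 ≤ K) (hK' : 2 * K ≤ α + β + 2) (hx₀ : -1 < x₀)
    (hF : (1 - x₀ ^ 2) * K ^ 2 + (β - α - (α + β + 2) * x₀) * K + n * (n + α + β + 1) < 0)
    (hs : jacobiP n α β s = 0) : s < x₀ := by
  by_contra! hle
  have hs1 : s < 1 := by
    by_contra! h
    exact (jacobiP_pos_of_one_le hα hβ h).ne' hs
  obtain ⟨y₁, y₂, h1, h2, hode⟩ := jacobiP_exists_ode n α β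
  refine pos_of_barrier (K := K) hs1 (hx₀.trans_le hle) h1 h2 hode (by linarith)
    (jacobiP_pos_of_one_le hα hβ le_rfl) (fun x hx => ?_) hs
  have hx' : x₀ ≤ x := hle.trans hx.1
  have h3 : 0 ≤ (x + x₀) * K + (α + β + 2) := by nlinarith
  nlinarith [mul_nonneg (mul_nonneg (sub_nonneg.2 hx') hK) h3]

theorem eventually_jacobiP_zero_le (α β : ℕ → ℝ) (c : ℝ) (hc : c > 0)
    (hα : ∀ n, α n > -1) (hβ : ∀ n, β n > -1)
    (hαlim : Tendsto (fun n : ℕ => α n / n) atTop atTop)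
    (hβlim : Tendsto (fun n : ℕ => β n / n) atTop atTop)
    (hq : Tendsto (fun n : ℕ => α n / β n) atTop (𝓝 c))
    (M : ℝ) (hM : 4 * c / (1 + c) ^ ((3 : ℝ) / 2) < M) :
    ∀ᶠ n : ℕ in atTop, ∀ s, jacobiP n (α n) (β n) s = 0 →
      Real.sqrt (α n / n) * (s + (α n - β n) / (α n + β n)) ≤ M := by
  have hM0 : 0 < M := lt_of_le_of_lt (by positivity) hM
  have hM2 : 16 * c ^ 2 < M ^ 2 * (1 + c) ^ 3 := by
    have hpow : ((1 + c) ^ ((3 : ℝ) / 2)) ^ 2 = (1 + c) ^ 3 := by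
      rw [← Real.rpow_natCast, ← Real.rpow_mul (by positivity), ← Real.rpow_natCast]
      norm_num
    have h1 : 4 * c < M * (1 + c) ^ ((3 : ℝ) / 2) := (div_lt_iff₀ (by positivity)).1 hM
    have h2 := pow_lt_pow_left₀ h1 (by positivity) two_ne_zero
    rw [mul_pow, mul_pow, hpow] at h2
    linarith
  set κ : ℝ := M * (1 + c) ^ 3 / (8 * c ^ 2) with hκ
  have hκ0 : 0 < κ := by positivity
  set t : ℕ → ℝ := fun n => (Real.sqrt (α n / n))⁻¹ with ht
  have ht0 : Tendsto t atTop (𝓝 0) :=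
    (Real.tendsto_sqrt_atTop.comp hαlim).inv_tendsto_atTop
  have hn0 : Tendsto (fun n : ℕ => ((n : ℝ))⁻¹) atTop (𝓝 0) :=
    tendsto_natCast_atTop_atTop.inv_tendsto_atTop
  have hX : Tendsto (fun n => (1 - α n / β n) / (1 + α n / β n) + M * t n) atTop
      (𝓝 ((1 - c) / (1 + c) + M * 0)) :=
    ((hq.const_sub 1).div (hq.const_add 1) (by positivity)).add (ht0.const_mul M)
  have hlim := ((((hX.pow 2).const_sub 1).mul_const (κ ^ 2)).sub
    ((((hq.inv₀ hc.ne').const_add 1).const_mul M).add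
      ((hX.const_mul 2).mul (ht0.mul hn0)) |>.const_mul κ)).add
    (((ht0.pow 2).add ((hq.inv₀ hc.ne').const_add 1)).add ((ht0.pow 2).mul hn0))
  have hneg : (1 - ((1 - c) / (1 + c) + M * 0) ^ 2) * κ ^ 2
      - κ * (M * (1 + c⁻¹) + 2 * ((1 - c) / (1 + c) + M * 0) * (0 * 0))
      + (0 ^ 2 + (1 + c⁻¹) + 0 ^ 2 * 0) < 0 := by
    have : (1 - ((1 - c) / (1 + c) + M * 0) ^ 2) * κ ^ 2
      - κ * (M * (1 + c⁻¹) + 2 * ((1 - c) / (1 + c) + M * 0) * (0 * 0))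
      + (0 ^ 2 + (1 + c⁻¹) + 0 ^ 2 * 0)
      = (1 + c) / (16 * c ^ 3) * (16 * c ^ 2 - M ^ 2 * (1 + c) ^ 3) := by
      rw [hκ]; field_simp; ring
    rw [this]
    exact mul_neg_of_pos_of_neg (by positivity) (by linarith)
  have hsmall : ∀ᶠ n in atTop, 2 * (κ * t n) < 1 := by
    have h := (ht0.const_mul κ).const_mul 2
    exact h.eventually_lt_const (by norm_num)
  filter_upwards [hlim.eventually_lt_const hneg, hsmall, hαlim.eventually_gt_atTop 0,
    hβlim.eventually_gt_atTop 0, eventually_gt_atTop 0] with n hG hKs ha hb hn s hs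
  have hn' : (0 : ℝ) < n := by exact_mod_cast hn
  have ha' : 0 < α n := (div_pos_iff_of_pos_right hn').1 ha
  have hb' : 0 < β n := (div_pos_iff_of_pos_right hn').1 hb
  have hsq : 0 < Real.sqrt (α n / n) := Real.sqrt_pos.2 ha
  have htn : 0 < t n := inv_pos.2 hsq
  have hn_eq : (n : ℝ) = α n * t n ^ 2 := by
    simp only [ht]
    rw [inv_pow, Real.sq_sqrt ha.le]
    field_simp
  set x₀ := (1 - α n / β n) / (1 + α n / β n) + M * t n with hx₀
  have hcenter : (1 - α n / β n) / (1 + α n / β n) = (β n - α n) / (α n + β n) := by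
    field_simp
    ring
  have hkey : s < x₀ := by
    refine jacobiP_zero_lt (K := κ * α n * t n) (hα n) (hβ n) (by positivity) ?_ ?_ ?_ hs
    · nlinarith
    · rw [hx₀, hcenter]
      have : -1 < (β n - α n) / (α n + β n) := by
        rw [lt_div_iff₀ (by positivity)]; linarith
      have := mul_pos hM0 htn
      linarith
    · have hx₀' : (β n - α n) = (x₀ - M * t n) * (α n + β n) := by
        rw [hx₀, hcenter]; field_simp; ring
      have hmul := mul_neg_of_pos_of_neg (by positivity : 0 < α n ^ 2 * t n ^ 2) hG
      refine lt_of_eq_of_lt ?_ hmul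
      rw [hx₀', inv_div, hn_eq]
      field_simp
      ring
  have h : s + (α n - β n) / (α n + β n) ≤ M * t n := by
    have : (α n - β n) / (α n + β n) = -((β n - α n) / (α n + β n)) := by ring
    rw [this, ← hcenter]
    linarith
  calc _ ≤ Real.sqrt (α n / n) * (M * t n) := mul_le_mul_of_nonneg_left h hsq.le
    _ = M := by simp only [ht]; field_simp

theorem Real.limsup_le_of_forall_gt {u : ℕ → ℝ} {L : ℝ} (hL : 0 ≤ L)
    (h : ∀ M, L < M → ∀ᶠ n in atTop, u n ≤ M) : limsup u atTop ≤ L := by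
  rw [limsup_eq]
  by_cases hbdd : BddBelow {a | ∀ᶠ n in atTop, u n ≤ a}
  · exact le_of_forall_gt_imp_ge_of_dense fun M hM => csInf_le hbdd (h M hM)
  · rw [Real.sInf_of_not_bddBelow hbdd]
    exact hL

theorem stmt19 (α β : ℕ → ℝ) (c : ℝ) (hc : c > 0)
    (hα : ∀ n, α n > -1) (hβ : ∀ n, β n > -1)
    (hαlim : Tendsto (fun n : ℕ => α n / n) atTop atTop)
    (hβlim : Tendsto (fun n : ℕ => β n / n) atTop atTop)
    (hq : Tendsto (fun n : ℕ => α n / β n) atTop (𝓝 c))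
    (s : ℕ → ℝ)
    (hs : ∀ n : ℕ, 1 ≤ n → IsGreatest {x : ℝ | jacobiP n (α n) (β n) x = 0} (s n)) :
    limsup (fun n : ℕ =>
        Real.sqrt (α n / n) * (s n + (α n - β n) / (α n + β n))) atTop ≤
      4 * c / (1 + c) ^ ((3 : ℝ) / 2) := by
  refine Real.limsup_le_of_forall_gt (by positivity) fun M hM => ?_
  filter_upwards [eventually_jacobiP_zero_le α β c hc hα hβ hαlim hβlim hq M hM,
    eventually_ge_atTop 1] with n hn h1 using hn _ (hs n h1).1
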